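/- arXiv:2501.17455 — 3 statements merged into one kernel-verified Lean document; each statement's English description precedes it below -/
import Mathlib

section
/- Let (Ω, ℙ) be a probability space, d ∈ ℕ, and let X : Ω → ℝ^d (bounded and measurable), Z : Ω → 𝒵 (measurable), and U₀, U₁, V : Ω → ℝ be random variables such that: V is uniformly distributed on [0,1]; the random vector (U₀, U₁, V) is independent of the pair (X, Z); U₀ and U₁ are integrable with E[U₀] = 0. Let π : 𝒵 → ℝ be measurable with values in [0,1], let β₀, β₁ ∈ ℝ^d, set D := 1{V ≤ π(Z)} and Y := D·(β₁'X + U₁) + (1 − D)·(β₀'X + U₀), and define Λ(t) := E[(U₁ − U₀)·1{V ≤ t}] for t ∈ [0,1]. Then, almost surely, E[Y | σ(X, Z)] = β₀'X + (β₁ − β₀)'X·π(Z) + Λ(π(Z)). -/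
open MeasureTheory

open ProbabilityTheory in
/-- If `W` is independent of `T`, the conditional expectation of `f (T, W)` given `T` is obtained
by integrating out `W` with `T` frozen. -/
theorem condExp_prodMk_ae_eq_integral_of_indepFun {Ω α γ F : Type*} [MeasurableSpace Ω]
    [MeasurableSpace α] [MeasurableSpace γ] [StandardBorelSpace γ] [Nonempty γ]
    [NormedAddCommGroup F] [NormedSpace ℝ F] [CompleteSpace F]
    {μ : Measure Ω} [IsProbabilityMeasure μ] {T : Ω → α} {W : Ω → γ}
    (hT : Measurable T) (hW : Measurable W) (h : IndepFun W T μ)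
    {f : α × γ → F} (hf : StronglyMeasurable f) (hfi : Integrable (fun ω => f (T ω, W ω)) μ) :
    μ[fun ω => f (T ω, W ω) | MeasurableSpace.comap T inferInstance]
      =ᵐ[μ] fun ω => ∫ ω', f (T ω, W ω') ∂μ := by
  have : IsProbabilityMeasure (μ.map W) := Measure.isProbabilityMeasure_map hW.aemeasurable
  have hk : condDistrib W T μ =ᵐ[μ.map T] Kernel.const α (μ.map W) := by
    rw [condDistrib_ae_eq_iff_measure_eq_compProd T hW.aemeasurable, Measure.compProd_const]
    exact h.symm.map_prod_eq_prod_map_map hT.aemeasurable hW.aemeasurable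
  filter_upwards [condExp_prod_ae_eq_integral_condDistrib hT hW.aemeasurable hf hfi,
    ae_of_ae_map hT.aemeasurable hk] with ω h₁ h₂
  rw [h₁, h₂, Kernel.const_apply]
  exact integral_map_of_stronglyMeasurable hW
    (hf.comp_measurable (measurable_const.prodMk measurable_id))

/-- A random variable uniform on `[0, 1]` has distribution function `p ↦ p` on `[0, 1]`. -/
theorem integral_ite_le_of_map_eq_uniform {Ω : Type*} [MeasurableSpace Ω] {μ : Measure Ω}
    {V : Ω → ℝ} (hV : Measurable V)
    (hVunif : μ.map V = volume.restrict (Set.Icc (0 : ℝ) 1)) {p : ℝ} (hp : p ∈ Set.Icc (0 : ℝ) 1) :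
    ∫ ω, (if V ω ≤ p then (1 : ℝ) else 0) ∂μ = p := by
  have hind : (fun ω => if V ω ≤ p then (1 : ℝ) else 0) =
      fun ω => (Set.Iic p).indicator (fun _ => (1 : ℝ)) (V ω) := by
    ext ω
    simp [Set.indicator_apply]
  have hinter : Set.Iic p ∩ Set.Icc (0 : ℝ) 1 = Set.Icc 0 p := by
    ext x
    simp only [Set.mem_inter_iff, Set.mem_Iic, Set.mem_Icc]
    exact ⟨fun h => ⟨h.2.1, h.1⟩, fun h => ⟨h.2, h.1, h.2.trans hp.2⟩⟩
  rw [hind, ← integral_map_of_stronglyMeasurable hV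
    (stronglyMeasurable_const.indicator measurableSet_Iic), hVunif,
    integral_indicator_const _ measurableSet_Iic, measureReal_def,
    Measure.restrict_apply measurableSet_Iic, hinter, Real.volume_Icc]
  simp [hp.1]

/-- A linear combination of bounded measurable coordinates is integrable. -/
theorem integrable_sum_mul_of_bounded {Ω ι : Type*} [Fintype ι] [MeasurableSpace Ω]
    {μ : Measure Ω} [IsFiniteMeasure μ] {X : Ω → ι → ℝ} (hX : Measurable X)
    (hXbd : ∃ C : ℝ, ∀ ω i, |X ω i| ≤ C) (β : ι → ℝ) :
    Integrable (fun ω => ∑ i, β i * X ω i) μ := by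
  obtain ⟨C, hC⟩ := hXbd
  refine integrable_finsetSum _ fun i _ => Integrable.const_mul ?_ _
  exact Integrable.of_bound (by fun_prop) C (Filter.Eventually.of_forall fun ω => hC ω i)

/-- Multiplication by the indicator of a measurable set preserves integrability. -/
theorem MeasureTheory.Integrable.ite_mul_of_le {Ω : Type*} [MeasurableSpace Ω] {μ : Measure Ω}
    {V q g : Ω → ℝ} (hg : Integrable g μ) (hV : Measurable V) (hq : Measurable q) :
    Integrable (fun ω => (if V ω ≤ q ω then (1 : ℝ) else 0) * g ω) μ := by
  refine (hg.indicator (measurableSet_le hV hq)).congr (Filter.Eventually.of_forall fun ω => ?_)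
  by_cases h : V ω ≤ q ω <;> simp [h]

/-- The partially linear representation
`E[Y | σ(X,Z)] = β₀'X + (β₁ − β₀)'X·π(Z) + Λ(π(Z))` a.s., where
`Y = D(β₁'X + U₁) + (1−D)(β₀'X + U₀)`, `D = 1{V ≤ π(Z)}`, `V ~ U[0,1]`,
`(U₀,U₁,V)` independent of `(X,Z)`, `U₀, U₁` integrable with `E[U₀] = 0`, `X` bounded,
and `Λ(t) = E[(U₁ − U₀)·1{V ≤ t}]`. -/
theorem stmt_10 {Ω 𝒵 : Type*} [MeasurableSpace Ω] [MeasurableSpace 𝒵]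
    (ℙ : Measure Ω) [IsProbabilityMeasure ℙ] (d : ℕ)
    (X : Ω → Fin d → ℝ) (hX : Measurable X) (hXbd : ∃ C : ℝ, ∀ ω i, |X ω i| ≤ C)
    (Z : Ω → 𝒵) (hZ : Measurable Z)
    (U₀ U₁ V : Ω → ℝ) (hU₀ : Measurable U₀) (hU₁ : Measurable U₁) (hV : Measurable V)
    (hVunif : Measure.map V ℙ = volume.restrict (Set.Icc (0 : ℝ) 1))
    (hindep : ProbabilityTheory.IndepFun
      (fun ω => (U₀ ω, U₁ ω, V ω)) (fun ω => (X ω, Z ω)) ℙ)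
    (hU₀int : Integrable U₀ ℙ) (hU₁int : Integrable U₁ ℙ)
    (hU₀mean : ∫ ω, U₀ ω ∂ℙ = 0)
    (π : 𝒵 → ℝ) (hπ : Measurable π) (hπ01 : ∀ z, π z ∈ Set.Icc (0 : ℝ) 1)
    (β₀ β₁ : Fin d → ℝ) :
    ℙ[(fun ω =>
        (if V ω ≤ π (Z ω) then (1 : ℝ) else 0) * ((∑ i, β₁ i * X ω i) + U₁ ω)
          + (1 - if V ω ≤ π (Z ω) then (1 : ℝ) else 0) * ((∑ i, β₀ i * X ω i) + U₀ ω)) |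
        MeasurableSpace.comap (fun ω => (X ω, Z ω)) inferInstance]
      =ᵐ[ℙ] fun ω =>
        (∑ i, β₀ i * X ω i)
          + (∑ i, (β₁ i - β₀ i) * X ω i) * π (Z ω)
          + ∫ ω', (U₁ ω' - U₀ ω') * (if V ω' ≤ π (Z ω) then (1 : ℝ) else 0) ∂ℙ := by
  have hb₀ := integrable_sum_mul_of_bounded (μ := ℙ) hX hXbd β₀
  have hb₁ := integrable_sum_mul_of_bounded (μ := ℙ) hX hXbd β₁
  let f : ((Fin d → ℝ) × 𝒵) × (ℝ × ℝ × ℝ) → ℝ := fun q =>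
    (if q.2.2.2 ≤ π q.1.2 then (1 : ℝ) else 0) * ((∑ i, β₁ i * q.1.1 i) + q.2.2.1)
      + (1 - if q.2.2.2 ≤ π q.1.2 then (1 : ℝ) else 0) * ((∑ i, β₀ i * q.1.1 i) + q.2.1)
  have hf : Measurable f := by
    have hD : Measurable fun q : ((Fin d → ℝ) × 𝒵) × (ℝ × ℝ × ℝ) =>
        if q.2.2.2 ≤ π q.1.2 then (1 : ℝ) else 0 :=
      Measurable.ite (measurableSet_le (by fun_prop) (by fun_prop)) measurable_const
        measurable_const
    fun_prop
  have hfi : Integrable (fun ω => f ((X ω, Z ω), (U₀ ω, U₁ ω, V ω))) ℙ := by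
    have h₁ := (hb₁.add hU₁int).ite_mul_of_le hV (hπ.comp hZ)
    have h₀ := (hb₀.add hU₀int).ite_mul_of_le hV (hπ.comp hZ)
    refine ((h₁.add (hb₀.add hU₀int)).sub h₀).congr (Filter.Eventually.of_forall fun ω => ?_)
    simp only [f, Pi.add_apply, Pi.sub_apply, Function.comp_apply]
    ring
  refine (condExp_prodMk_ae_eq_integral_of_indepFun (hX.prodMk hZ)
    (hU₀.prodMk (hU₁.prodMk hV)) hindep hf.stronglyMeasurable hfi).trans
    (Filter.Eventually.of_forall fun ω => ?_)
  have hsum : ∑ i, (β₁ i - β₀ i) * X ω i = (∑ i, β₁ i * X ω i) - ∑ i, β₀ i * X ω i := by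
    simp only [sub_mul, Finset.sum_sub_distrib]
  simp only [f, hsum]
  generalize ∑ i, β₁ i * X ω i = b₁
  generalize ∑ i, β₀ i * X ω i = b₀
  have hD : Integrable (fun ω' => if V ω' ≤ π (Z ω) then (1 : ℝ) else 0) ℙ := by
    simpa using (integrable_const (μ := ℙ) (1 : ℝ)).ite_mul_of_le hV
      (measurable_const (a := π (Z ω)))
  have hUD : Integrable
      (fun ω' => (U₁ ω' - U₀ ω') * (if V ω' ≤ π (Z ω) then (1 : ℝ) else 0)) ℙ := by
    simpa [mul_comm] using (hU₁int.sub hU₀int).ite_mul_of_le hV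
      (measurable_const (a := π (Z ω)))
  have hbD : Integrable
      (fun ω' => b₀ + (b₁ - b₀) * (if V ω' ≤ π (Z ω) then (1 : ℝ) else 0)) ℙ :=
    (integrable_const _).add (hD.const_mul _)
  have hUDU : Integrable
      (fun ω' => (U₁ ω' - U₀ ω') * (if V ω' ≤ π (Z ω) then (1 : ℝ) else 0) + U₀ ω') ℙ :=
    hUD.add hU₀int
  calc
    _ = ∫ ω', (b₀ + (b₁ - b₀) * (if V ω' ≤ π (Z ω) then (1 : ℝ) else 0))
          + ((U₁ ω' - U₀ ω') * (if V ω' ≤ π (Z ω) then (1 : ℝ) else 0) + U₀ ω') ∂ℙ := by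
      congr 1
      ext ω'
      ring
    _ = _ := by
      rw [integral_add hbD hUDU,
        integral_add (integrable_const _) (hD.const_mul _), integral_add hUD hU₀int,
        integral_const_mul, integral_ite_le_of_map_eq_uniform hV hVunif (hπ01 _), hU₀mean]
      simp
end

section
/- Let K : ℝ → ℝ be Borel measurable, bounded, compactly supported, and symmetric (K(−u) = K(u) for all u). Let f : ℝ → ℝ be twice differentiable with |f''(x)| ≤ M for all x. Then for every p ∈ ℝ and every h > 0, |(1/h)·∫_ℝ K((x − p)/h)·f(x) dx − f(p)·∫_ℝ K(u) du| ≤ (M h²/2)·∫_ℝ u²|K(u)| du. -/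
open MeasureTheory

/-- Second-order Taylor bound on the real line, assuming only that the second derivative exists. -/
theorem abs_sub_sub_mul_le_of_abs_deriv_two_le {f f' f'' : ℝ → ℝ}
    (hf' : ∀ x, HasDerivAt f (f' x) x) (hf'' : ∀ x, HasDerivAt f' (f'' x) x)
    {M : ℝ} (hM : ∀ x, |f'' x| ≤ M) (a d : ℝ) :
    |f (a + d) - f a - f' a * d| ≤ M / 2 * d ^ 2 := by
  have hlip (y : ℝ) : |f' y - f' a| ≤ M * |y - a| := by
    simpa only [Real.norm_eq_abs] using
      convex_univ.norm_image_sub_le_of_norm_hasDerivWithin_le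
        (fun x _ => (hf'' x).hasDerivWithinAt) (fun x _ => hM x)
        (Set.mem_univ a) (Set.mem_univ y)
  have hg (t : ℝ) : HasDerivAt (fun t => f (a + t * d) - f a - f' a * (t * d))
      ((f' (a + t * d) - f' a) * d) t := by
    have hlin : HasDerivAt (fun t : ℝ => t * d) d t := by
      simpa using (hasDerivAt_id t).mul_const d
    have := (((hf' (a + t * d)).comp t (hlin.const_add a)).sub_const (f a)).sub
      (hlin.const_mul (f' a))
    exact this.congr_deriv (by ring)
  have hB (t : ℝ) : HasDerivAt (fun t => M / 2 * d ^ 2 * t ^ 2) (M * d ^ 2 * t) t :=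
    ((hasDerivAt_pow 2 t).const_mul (M / 2 * d ^ 2)).congr_deriv (by push_cast; ring)
  have key := image_norm_le_of_norm_deriv_right_le_deriv_boundary (a := 0) (b := 1)
    (fun t _ => (hg t).continuousAt.continuousWithinAt)
    (fun t _ => (hg t).hasDerivWithinAt) (by simp) hB
    (fun t ht => by
      have h1 := mul_le_mul_of_nonneg_right (hlip (a + t * d)) (abs_nonneg d)
      rw [Real.norm_eq_abs, abs_mul]
      refine h1.trans_eq ?_
      rw [add_sub_cancel_left, abs_mul, abs_of_nonneg ht.1, ← sq_abs d]
      ring)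
    (Set.right_mem_Icc.2 zero_le_one)
  simpa using key

/-- A bounded measurable function with compact support is integrable against any continuous
function. -/
theorem HasCompactSupport.integrable_mul_continuous {K g : ℝ → ℝ} (hK : HasCompactSupport K)
    (hKmeas : Measurable K) (hKbd : ∃ C : ℝ, ∀ u, |K u| ≤ C) (hg : Continuous g) :
    Integrable fun u => K u * g u := by
  obtain ⟨C, hC⟩ := hKbd
  have hKint : IntegrableOn K (tsupport K) :=
    Measure.integrableOn_of_bounded hK.isCompact.measure_lt_top.ne
      hKmeas.aestronglyMeasurable (M := C) (ae_of_all _ hC)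
  refine (integrableOn_iff_integrable_of_support_subset ?_).1
    (hKint.mul_continuousOn hg.continuousOn hK.isCompact)
  exact (Function.support_mul_subset_left K g).trans (subset_tsupport K)

/-- The first moment of a symmetric kernel vanishes. -/
theorem integral_mul_id_eq_zero_of_even {K : ℝ → ℝ} (hK : ∀ u, K (-u) = K u) :
    ∫ u, K u * u = 0 := by
  have h := integral_neg_eq_self (fun u => K u * u) volume
  simp only [hK, mul_neg, integral_neg] at h
  linarith

/-- Rescaling a kernel-weighted integral to the reference kernel. -/
theorem integral_kernel_rescale (K f : ℝ → ℝ) (p : ℝ) {h : ℝ} (hh : 0 < h) :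
    (1 / h) * ∫ x, K ((x - p) / h) * f x = ∫ u, K u * f (p + h * u) := by
  have h1 := integral_sub_right_eq_self (μ := volume)
    (fun x => K (x / h) * f (p + h * (x / h))) p
  rw [Measure.integral_comp_div (fun u => K u * f (p + h * u)) h, abs_of_pos hh,
    smul_eq_mul] at h1
  have h2 (x : ℝ) : p + h * ((x - p) / h) = x := by field_simp; ring
  simp only [h2] at h1
  rw [h1, one_div, inv_mul_cancel_left₀ hh.ne']

/-- second-order bias expansion for the kernel-weighted zeroth moment.
For a bounded, compactly supported, symmetric measurable kernel `K` and `f` twice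
differentiable with `|f''| ≤ M`,
`|(1/h)·∫ K((x−p)/h) f(x) dx − f(p)·∫ K(u) du| ≤ (M h²/2)·∫ u²|K(u)| du`. -/
theorem stmt_12 (K : ℝ → ℝ) (hKmeas : Measurable K) (hKbd : ∃ C : ℝ, ∀ u, |K u| ≤ C)
    (hKsupp : HasCompactSupport K) (hKsymm : ∀ u, K (-u) = K u)
    (f f' f'' : ℝ → ℝ)
    (hf' : ∀ x, HasDerivAt f (f' x) x) (hf'' : ∀ x, HasDerivAt f' (f'' x) x)
    (M : ℝ) (hM : ∀ x, |f'' x| ≤ M)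
    (p h : ℝ) (hh : 0 < h) :
    |(1 / h) * (∫ x, K ((x - p) / h) * f x) - f p * ∫ u, K u|
      ≤ M * h ^ 2 / 2 * ∫ u, u ^ 2 * |K u| := by
  have hKg {g : ℝ → ℝ} (hg : Continuous g) : Integrable fun u => K u * g u :=
    hKsupp.integrable_mul_continuous hKmeas hKbd hg
  have hfc : Continuous f := continuous_iff_continuousAt.2 fun x => (hf' x).continuousAt
  have hK0 : Integrable fun u => K u * f p := hKg continuous_const
  have hK1 : Integrable fun u => K u * u * (f' p * h) := (hKg continuous_id).mul_const _
  have hKf : Integrable fun u => K u * f (p + h * u) := hKg (by fun_prop)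
  have hK2 : Integrable fun u => u ^ 2 * |K u| := by
    refine (hKg (continuous_pow 2)).abs.congr (ae_of_all _ fun u => ?_)
    simp only [abs_mul, abs_of_nonneg (sq_nonneg u), mul_comm]
  have hdiff : (1 / h) * (∫ x, K ((x - p) / h) * f x) - f p * ∫ u, K u
      = ∫ u, (K u * f (p + h * u) - K u * f p - K u * u * (f' p * h)) := by
    rw [integral_sub (f := fun u => K u * f (p + h * u) - K u * f p) (hKf.sub hK0) hK1,
      integral_sub hKf hK0, integral_mul_const, integral_mul_const,
      integral_mul_id_eq_zero_of_even hKsymm, integral_kernel_rescale K f p hh]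
    ring
  rw [hdiff, ← integral_const_mul, ← Real.norm_eq_abs]
  refine norm_integral_le_of_norm_le (hK2.const_mul _) (ae_of_all _ fun u => ?_)
  have htaylor := mul_le_mul_of_nonneg_left
    (abs_sub_sub_mul_le_of_abs_deriv_two_le hf' hf'' hM p (h * u)) (abs_nonneg (K u))
  rw [← abs_mul] at htaylor
  rw [Real.norm_eq_abs]
  calc
    _ = |K u * (f (p + h * u) - f p - f' p * (h * u))| := by ring_nf
    _ ≤ _ := htaylor
    _ = _ := by ring
end

section
/- Let K : ℝ → ℝ be Borel measurable, bounded, compactly supported, and symmetric (K(−u) = K(u) for all u). Let f : ℝ → ℝ be twice differentiable with |f''(x)| ≤ M for all x. Then for every p ∈ ℝ and every h > 0, |(1/h)·∫_ℝ K((x − p)/h)·(x − p)·f(x) dx − h²·f'(p)·∫_ℝ u²K(u) du| ≤ (M h³/2)·∫_ℝ |u|³|K(u)| du. -/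
open MeasureTheory

theorem abs_sub_taylor_one_le {f f' f'' : ℝ → ℝ} (hf' : ∀ x, HasDerivAt f (f' x) x)
    (hf'' : ∀ x, HasDerivAt f' (f'' x) x) {M : ℝ} (hM : ∀ x, |f'' x| ≤ M) (p t : ℝ) :
    |f (p + t) - f p - f' p * t| ≤ M * t ^ 2 / 2 := by
  have lipschitz : ∀ y, |f' y - f' p| ≤ M * |y - p| := fun y =>
    convex_univ.norm_image_sub_le_of_norm_hasDerivWithin_le
      (fun x _ => (hf'' x).hasDerivWithinAt) (fun x _ => hM x) (Set.mem_univ p) (Set.mem_univ y)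
  have hderiv : ∀ s : ℝ, HasDerivAt (fun s => f (p + s * t) - f p - f' p * (s * t))
      ((f' (p + s * t) - f' p) * t) s := by
    intro s
    have hlin : HasDerivAt (fun s : ℝ => s * t) t s := by
      simpa using (hasDerivAt_id s).mul_const t
    have hcomp := (hf' (p + s * t)).comp s (hlin.const_add p)
    exact ((hcomp.sub_const (f p)).sub (hlin.const_mul (f' p))).congr_deriv (by ring)
  have hbound : ∀ s : ℝ, HasDerivAt (fun s => M * t ^ 2 / 2 * s ^ 2) (M * t ^ 2 * s) s := by
    intro s
    exact ((hasDerivAt_pow 2 s).const_mul (M * t ^ 2 / 2)).congr_deriv (by norm_num; ring)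
  have key := image_norm_le_of_norm_deriv_right_le_deriv_boundary (a := 0) (b := 1)
    (fun s _ => (hderiv s).continuousAt.continuousWithinAt)
    (fun s _ => (hderiv s).hasDerivWithinAt) (by simp) hbound
    (fun s hs => by
      have hL := mul_le_mul_of_nonneg_right (lipschitz (p + s * t)) (abs_nonneg t)
      rw [add_sub_cancel_left, abs_mul, abs_of_nonneg hs.1] at hL
      rw [Real.norm_eq_abs, abs_mul]
      refine hL.trans_eq ?_
      rw [← sq_abs t]
      ring)
    (Set.right_mem_Icc.2 zero_le_one)
  simpa using key

theorem integrable_continuous_mul_of_hasCompactSupport {K φ : ℝ → ℝ} (hKmeas : Measurable K)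
    (hKbd : ∃ C : ℝ, ∀ u, |K u| ≤ C) (hKsupp : HasCompactSupport K) (hφ : Continuous φ) :
    Integrable fun u => φ u * K u := by
  obtain ⟨C, hC⟩ := hKbd
  have hK : IntegrableOn K (tsupport K) :=
    IntegrableOn.of_bound hKsupp.isCompact.measure_lt_top hKmeas.aestronglyMeasurable C
      (Filter.Eventually.of_forall hC)
  refine (integrableOn_iff_integrable_of_support_subset ?_).1
    (hK.continuousOn_mul hφ.continuousOn hKsupp.isCompact)
  exact (Function.support_mul_subset_right φ K).trans (subset_tsupport K)

theorem integral_mul_eq_zero_of_even {K : ℝ → ℝ} (hKsymm : ∀ u, K (-u) = K u) :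
    ∫ u, u * K u = 0 := by
  have hneg := integral_neg_eq_self (fun u => u * K u) volume
  simp only [hKsymm, neg_mul, integral_neg] at hneg
  linarith

/-- bias expansion for the kernel-weighted first moment.
For a bounded, compactly supported, symmetric measurable kernel `K` and `f` twice
differentiable with `|f''| ≤ M`,
`|(1/h)·∫ K((x−p)/h)(x−p) f(x) dx − h² f'(p) ∫ u²K(u) du| ≤ (M h³/2)·∫ |u|³|K(u)| du`. -/
theorem stmt_13 (K : ℝ → ℝ) (hKmeas : Measurable K) (hKbd : ∃ C : ℝ, ∀ u, |K u| ≤ C)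
    (hKsupp : HasCompactSupport K) (hKsymm : ∀ u, K (-u) = K u)
    (f f' f'' : ℝ → ℝ)
    (hf' : ∀ x, HasDerivAt f (f' x) x) (hf'' : ∀ x, HasDerivAt f' (f'' x) x)
    (M : ℝ) (hM : ∀ x, |f'' x| ≤ M)
    (p h : ℝ) (hh : 0 < h) :
    |(1 / h) * (∫ x, K ((x - p) / h) * (x - p) * f x)
        - h ^ 2 * f' p * ∫ u, u ^ 2 * K u|
      ≤ M * h ^ 3 / 2 * ∫ u, |u| ^ 3 * |K u| := by
  have hint : ∀ {φ : ℝ → ℝ}, Continuous φ → Integrable fun u => φ u * K u :=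
    integrable_continuous_mul_of_hasCompactSupport hKmeas hKbd hKsupp
  have hfc : Continuous f := continuous_iff_continuousAt.2 fun x => (hf' x).continuousAt
  have hsubst : ∫ x, K ((x - p) / h) * (x - p) * f x
      = h * ∫ u, h * (u * f (p + h * u) * K u) := by
    have hshift := integral_sub_right_eq_self (μ := volume)
      (fun y => (fun u => h * (u * f (p + h * u) * K u)) (y / h)) p
    rw [Measure.integral_comp_div (fun u => h * (u * f (p + h * u) * K u)), smul_eq_mul, abs_of_pos hh] at hshift
    rw [← hshift]
    congr 1
    ext x
    have hx : h * ((x - p) / h) = x - p := by field_simp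
    simp only [hx, add_sub_cancel]
    linear_combination (-(f x * K ((x - p) / h))) * hx
  have hi₀ : Integrable fun u => h * (u * f (p + h * u) * K u) :=
    (hint (by fun_prop)).const_mul h
  have hi₁ : Integrable fun u => h * f p * (u * K u) := (hint continuous_id).const_mul _
  have hi₂ : Integrable fun u => h ^ 2 * f' p * (u ^ 2 * K u) :=
    (hint (by fun_prop)).const_mul _
  have hi₃ : Integrable fun u => |u| ^ 3 * |K u| := by
    have hcube : Integrable fun u => u ^ 3 * K u := hint (by fun_prop)
    simpa only [abs_mul, abs_pow] using hcube.abs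
  have hremainder : (1 / h) * (∫ x, K ((x - p) / h) * (x - p) * f x)
        - h ^ 2 * f' p * ∫ u, u ^ 2 * K u
      = ∫ u, h * (u * K u) * (f (p + h * u) - f p - f' p * (h * u)) := by
    have hsplit : ∫ u, h * (u * K u) * (f (p + h * u) - f p - f' p * (h * u))
        = ∫ u, (h * (u * f (p + h * u) * K u) - h * f p * (u * K u)
            - h ^ 2 * f' p * (u ^ 2 * K u)) := by
      congr 1
      ext u
      ring
    rw [hsplit, integral_sub (by exact hi₀.sub hi₁) hi₂, integral_sub hi₀ hi₁,
      integral_const_mul (h * f p), integral_mul_eq_zero_of_even hKsymm,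
      integral_const_mul (h ^ 2 * f' p), hsubst]
    field_simp
    ring
  rw [hremainder, ← integral_const_mul, ← Real.norm_eq_abs]
  refine norm_integral_le_of_norm_le (hi₃.const_mul _) (Filter.Eventually.of_forall fun u => ?_)
  rw [Real.norm_eq_abs, abs_mul, abs_mul, abs_mul, abs_of_pos hh]
  calc h * (|u| * |K u|) * |f (p + h * u) - f p - f' p * (h * u)|
      ≤ h * (|u| * |K u|) * (M * (h * u) ^ 2 / 2) := by
        gcongr
        exact abs_sub_taylor_one_le hf' hf'' hM p (h * u)
    _ = M * h ^ 3 / 2 * (|u| ^ 3 * |K u|) := by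
        rw [mul_pow, ← sq_abs u]
        ring
end
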